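/- For any rotor-router execution, any time T, and any Δt ≥ 1, the following are equivalent: (i) S_T admits a Δt-step subcycle decomposition; (ii) for every vertex v and all t ≤ t' with T ≤ t and t' ≤ T + Δt, the multiset {C_t^{t'}(e) : e ∈ in(v)} equals the multiset {C_{t+1}^{t'+1}(e) : e ∈ out(v)}; (iii) for all such t, t', the multiset {C_t^{t'}(e) : e ∈ E⃗} equals the multiset {C_{t+1}^{t'+1}(e) : e ∈ E⃗}; (iv) for every 0 ≤ i ≤ Δt, Φ_i(S_T) = Φ_i(S_{T+1}) = ⋯ = Φ_i(S_{T+Δt−i+1}); (v) for every vertex v, all e_1, e_2 ∈ in(v), and all such t, t', |C_t^{t'}(e_1) − C_t^{t'}(e_2)| ≤ 1. -/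

import Mathlib

open Finset

namespace RotorRouter

variable {V : Type} [Fintype V] [DecidableEq V] (G : SimpleGraph V) [DecidableRel G.Adj]

/-- The outgoing arcs (darts) of a vertex `v`. -/
def outArcs (v : V) : Finset G.Dart := Finset.univ.filter (fun d => d.fst = v)

/-- The incoming arcs (darts) of a vertex `v`. -/
def inArcs (v : V) : Finset G.Dart := Finset.univ.filter (fun d => d.snd = v)

/-- A state of the rotor-router system: at each vertex, the current pointer
(represented as an index, in the fixed cyclic order, of an outgoing arc) and the
number of tokens currently located at the vertex. -/
structure State where
  ptr : V → ℕ
  tokens : V → ℕ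
  ptr_lt : ∀ v : V, 0 < G.degree v → ptr v < G.degree v

variable (ord : ∀ v : V, Fin (G.degree v) ≃ {d : G.Dart // d.fst = v})

/-- The number of tokens sent out on the `j`-th outgoing arc when `k` tokens leave a
vertex of degree `deg` in round-robin fashion, starting from pointer position `p`. -/
def sentCount (deg p k j : ℕ) : ℕ :=
  ((Finset.range k).filter (fun i => (p + i) % deg = j)).card

/-- The number of tokens sent along the arc `d` during one step from state `S`. -/
def arcLoad (S : State G) (d : G.Dart) : ℕ :=
  sentCount (G.degree d.fst) (S.ptr d.fst) (S.tokens d.fst)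
    (((ord d.fst).symm ⟨d, rfl⟩ : Fin (G.degree d.fst)) : ℕ)

/-- One synchronous step of the rotor-router system: every vertex sends out all of its
tokens in round-robin fashion, advancing its pointer after each token. -/
def step (S : State G) : State G where
  ptr v := if 0 < G.degree v then (S.ptr v + S.tokens v) % G.degree v else S.ptr v
  tokens v := (∑ d ∈ inArcs G v, arcLoad G ord S d) +
    (if 0 < G.degree v then 0 else S.tokens v)
  ptr_lt v h := by simp only [if_pos h]; exact Nat.mod_lt _ h

/-- `evol S0 t` is the state `S_t` reached after `t` steps from the initial state `S0`. -/
def evol (S0 : State G) (t : ℕ) : State G := (step G ord)^[t] S0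

/-- `load S0 t d` is `L_t(d)`, the number of tokens sent along arc `d` during step `t`. -/
def load (S0 : State G) (t : ℕ) (d : G.Dart) : ℕ := arcLoad G ord (evol G ord S0 t) d

/-- `cum S0 t1 t2 d` is the cumulative load `C_{t1}^{t2}(d) = Σ_{t1 ≤ t < t2} L_t(d)`. -/
def cum (S0 : State G) (t1 t2 : ℕ) (d : G.Dart) : ℕ :=
  ∑ t ∈ Finset.Ico t1 t2, load G ord S0 t d

/-- `cumV S0 t1 t2 v` is the cumulative vertex load `C_{t1}^{t2}(v)`. -/
def cumV (S0 : State G) (t1 t2 : ℕ) (v : V) : ℕ :=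
  ∑ t ∈ Finset.Ico t1 t2, (evol G ord S0 t).tokens v

/-- `pot S0 i t` is the `i`-th potential `Φ_i(S_t) = Σ_{e} (C_t^{t+i}(e))²`. -/
def pot (S0 : State G) (i t : ℕ) : ℕ := ∑ d : G.Dart, (cum G ord S0 t (t + i) d) ^ 2

/-- A state `S_t` is stable if it repeats: `S_{t'} = S_t` for some `t' > t`. -/
def IsStable (S0 : State G) (t : ℕ) : Prop :=
  ∃ t' > t, evol G ord S0 t' = evol G ord S0 t

/-- A family of bijections `in(v) → out(v)` (encoded as a global bijection `M` on darts
with `(M d).fst = d.snd`) is valid w.r.t. the `Δt`-step subcycle decomposition of `S_T`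
if `L_t(e) = L_{t+1}(M e)` for all arcs `e` and all `T ≤ t < T + Δt`. -/
def ValidMapping (S0 : State G) (T Δt : ℕ) (M : G.Dart → G.Dart) : Prop :=
  Function.Bijective M ∧ (∀ d : G.Dart, (M d).fst = d.snd) ∧
    ∀ (d : G.Dart) (t : ℕ), T ≤ t → t < T + Δt →
      load G ord S0 t d = load G ord S0 (t + 1) (M d)

/-- `S_T` admits a `Δt`-step subcycle decomposition. -/
def HasSubcycleDecomp (S0 : State G) (T Δt : ℕ) : Prop :=
  ∃ M : G.Dart → G.Dart, ValidMapping G ord S0 T Δt M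



section Sequences

/-- Monotone integer tuples of spread at most one are determined by their sum. -/
lemma monotone_eq_of_sum_eq {n : ℕ} {a b : Fin n → ℤ} (ha : Monotone a) (hb : Monotone b)
    (ha1 : ∀ i j, a i - a j ≤ 1) (hb1 : ∀ i j, b i - b j ≤ 1)
    (hsum : ∑ i, a i = ∑ i, b i) : a = b := by
  have key : ∀ {a b : Fin n → ℤ}, Monotone a → Monotone b → (∀ i j, a i - a j ≤ 1) →
      (∀ i j, b i - b j ≤ 1) → ∑ i, a i = ∑ i, b i → ∀ k, b k ≤ a k := by
    intro a b ha hb ha1 hb1 hsum k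
    by_contra! hk
    obtain ⟨j, hj⟩ : ∃ j, b j < a j := by
      by_contra! hle
      exact (Finset.sum_lt_sum (fun i _ => hle i) ⟨k, Finset.mem_univ k, hk⟩).ne hsum
    rcases le_total k j with h | h
    · have := hb h
      have := ha1 j k
      omega
    · have := ha h
      have := hb1 k j
      omega
  exact funext fun k => le_antisymm (key hb ha hb1 ha1 hsum.symm k) (key ha hb ha1 hb1 hsum k)

/-- A family of integer sequences starting at `0` whose increments over every window inside
`[0, N]` differ pairwise by at most one. -/
def BalancedFamily {ι : Type*} (N : ℕ) (f : ι → ℕ → ℤ) : Prop :=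
  (∀ e, f e 0 = 0) ∧ ∀ e e' s s', s ≤ s' → s' ≤ N → |(f e s' - f e s) - (f e' s' - f e' s)| ≤ 1

lemma BalancedFamily.sub_le_one {ι : Type*} {N : ℕ} {f : ι → ℕ → ℤ} (hf : BalancedFamily N f)
    (e e' : ι) {s : ℕ} (hs : s ≤ N) : f e s - f e' s ≤ 1 := by
  have := abs_le.1 (hf.2 e e' 0 s s.zero_le hs)
  rw [hf.1, hf.1] at this
  omega

lemma BalancedFamily.le_of_lt {ι : Type*} {N : ℕ} {f : ι → ℕ → ℤ} (hf : BalancedFamily N f)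
    {e e' : ι} {s s' : ℕ} (hs : s ≤ N) (hs' : s' ≤ N) (h : f e s < f e' s) :
    f e s' ≤ f e' s' := by
  rcases le_total s s' with hss | hss
  · have := abs_le.1 (hf.2 e e' s s' hss hs')
    omega
  · have := abs_le.1 (hf.2 e e' s' s hss hs)
    omega

/-- The members of a balanced family can be listed in pointwise increasing order. -/
lemma BalancedFamily.exists_equiv_monotone {ι : Type*} [Fintype ι] {N n : ℕ} {f : ι → ℕ → ℤ}
    (hf : BalancedFamily N f) (hn : Fintype.card ι = n) :
    ∃ σ : Fin n ≃ ι, ∀ s ≤ N, Monotone fun i => f (σ i) s := by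
  let σ₀ := (Fintype.equivFinOfCardEq hn).symm
  let total : Fin n → ℤ := fun i => ∑ s ∈ Finset.range (N + 1), f (σ₀ i) s
  refine ⟨(Tuple.sort total).trans σ₀, fun s hs i j hij => ?_⟩
  by_contra! hlt
  refine absurd (Tuple.monotone_sort total hij) (not_le.2 ?_)
  refine Finset.sum_lt_sum (fun s' hs' => ?_) ⟨s, by simpa [Nat.lt_succ_iff] using hs, hlt⟩
  exact hf.le_of_lt hs (Nat.lt_succ_iff.1 (Finset.mem_range.1 hs')) hlt

/-- Two balanced families with the same sums agree up to a relabelling. -/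
lemma BalancedFamily.exists_equiv {ι κ : Type*} [Fintype ι] [Fintype κ] {N : ℕ}
    {f : ι → ℕ → ℤ} {g : κ → ℕ → ℤ} (hf : BalancedFamily N f) (hg : BalancedFamily N g)
    (hcard : Fintype.card ι = Fintype.card κ)
    (hsum : ∀ s ≤ N, ∑ e, f e s = ∑ e, g e s) :
    ∃ φ : ι ≃ κ, ∀ e, ∀ s ≤ N, f e s = g (φ e) s := by
  obtain ⟨σ, hσ⟩ := hf.exists_equiv_monotone hcard
  obtain ⟨τ, hτ⟩ := hg.exists_equiv_monotone rfl
  refine ⟨σ.symm.trans τ, fun e s hs => ?_⟩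
  have := monotone_eq_of_sum_eq (hσ s hs) (hτ s hs) (fun i j => hf.sub_le_one _ _ hs)
    (fun i j => hg.sub_le_one _ _ hs)
    (by rw [σ.sum_comp fun e => f e s, τ.sum_comp fun e => g e s, hsum s hs])
  simpa using congrFun this (σ.symm e)

lemma sum_sub_mul_sub_succ {α : Type*} (A : Finset α) (h : α → ℤ) (q : ℤ) :
    ∑ e ∈ A, (h e - q) * (h e - (q + 1)) =
      ∑ e ∈ A, h e ^ 2 - (2 * q + 1) * ∑ e ∈ A, h e + A.card * (q * (q + 1)) := by
  rw [Finset.mul_sum, ← nsmul_eq_mul, ← Finset.sum_const, ← Finset.sum_sub_distrib,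
    ← Finset.sum_add_distrib]
  exact Finset.sum_congr rfl fun e _ => by ring

/-- The excess of the sum of squares of `f` over that of a two-valued `g` with the same sum. -/
lemma sum_sq_sub_sum_sq {α β : Type*} {I : Finset α} {O : Finset β} {f : α → ℤ} {g : β → ℤ}
    {q : ℤ} (hcard : I.card = O.card) (hsum : ∑ e ∈ I, f e = ∑ e ∈ O, g e)
    (hg : ∀ e ∈ O, g e = q ∨ g e = q + 1) :
    ∑ e ∈ I, f e ^ 2 - ∑ e ∈ O, g e ^ 2 = ∑ e ∈ I, (f e - q) * (f e - (q + 1)) := by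
  have hO : ∑ e ∈ O, (g e - q) * (g e - (q + 1)) = 0 :=
    Finset.sum_eq_zero fun e he => by rcases hg e he with h | h <;> simp [h]
  rw [sum_sub_mul_sub_succ] at hO
  rw [sum_sub_mul_sub_succ, hcard, hsum]
  linarith

end Sequences

section SentCount

lemma sentCount_add (deg p k l j : ℕ) :
    sentCount deg p (k + l) j = sentCount deg p k j + sentCount deg ((p + k) % deg) l j := by
  simp only [sentCount, Finset.card_filter, Finset.sum_range_add, Nat.mod_add_mod, add_assoc]

lemma sentCount_eq_or {deg p j : ℕ} (k : ℕ) (hj : j < deg) (hp : p < deg) :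
    sentCount deg p k j = k / deg ∨ sentCount deg p k j = k / deg + 1 := by
  have h : sentCount deg p k j = k.count (· ≡ j + (deg - p) [MOD deg]) := by
    rw [sentCount, Nat.count_eq_card_filter_range]
    congr 1
    refine Finset.filter_congr fun i _ => ?_
    rw [← Nat.ModEq.add_iff_left (Nat.ModEq.refl p), Nat.ModEq,
      show p + (j + (deg - p)) = j + deg by omega, Nat.add_mod_right, Nat.mod_eq_of_lt hj]
  rw [h, Nat.count_modEq_card _ (by omega)]
  split_ifs <;> simp

lemma sum_sentCount {deg : ℕ} (hdeg : 0 < deg) (p k : ℕ) :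
    ∑ j : Fin deg, sentCount deg p k j = k := by
  rw [Fin.sum_univ_eq_sum_range (sentCount deg p k) deg]
  simp only [sentCount]
  rw [← Finset.card_eq_sum_card_fiberwise fun i _ => by
    simpa using Nat.mod_lt (p + i) hdeg, Finset.card_range]

end SentCount

section Arcs

variable {G}

lemma mem_inArcs {v : V} {d : G.Dart} : d ∈ inArcs G v ↔ d.snd = v := by simp [inArcs]

lemma mem_outArcs {v : V} {d : G.Dart} : d ∈ outArcs G v ↔ d.fst = v := by simp [outArcs]

lemma card_inArcs (v : V) : (inArcs G v).card = (outArcs G v).card :=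
  Finset.card_bij' (fun d _ => d.symm) (fun d _ => d.symm)
    (by simp [mem_inArcs, mem_outArcs]) (by simp [mem_inArcs, mem_outArcs])
    (by simp) (by simp)

lemma sum_inArcs {M : Type*} [AddCommMonoid M] (f : G.Dart → M) :
    ∑ v, ∑ d ∈ inArcs G v, f d = ∑ d, f d :=
  Finset.sum_fiberwise _ _ _

lemma sum_outArcs {M : Type*} [AddCommMonoid M] (f : G.Dart → M) :
    ∑ v, ∑ d ∈ outArcs G v, f d = ∑ d, f d :=
  Finset.sum_fiberwise _ _ _

lemma map_val_eq_sum_singleton {α β : Type*} (s : Finset α) (f : α → β) :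
    Multiset.map f s.val = ∑ d ∈ s, ({f d} : Multiset β) := by
  rw [Finset.sum, ← Multiset.sum_map_singleton (Multiset.map f s.val), Multiset.map_map]
  rfl

lemma degree_pos_of_dart {W : Type*} {H : SimpleGraph W} (d : H.Dart)
    [Fintype (H.neighborSet d.fst)] : 0 < H.degree d.fst :=
  (H.degree_pos_iff_exists_adj _).2 ⟨d.snd, d.adj⟩

lemma sum_outArcs_arcLoad (S : State G) {v : V} (hv : 0 < G.degree v) :
    ∑ d ∈ outArcs G v, arcLoad G ord S d = S.tokens v := by
  rw [← sum_sentCount hv (S.ptr v) (S.tokens v)]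
  symm
  refine Finset.sum_bij (fun j _ => (ord v j : G.Dart)) (fun j _ => ?_) (fun i _ j _ h => ?_)
    (fun d hd => ?_) (fun j _ => ?_)
  · exact mem_outArcs.2 (ord v j).2
  · exact (ord v).injective (Subtype.ext h)
  · exact ⟨(ord v).symm ⟨d, mem_outArcs.1 hd⟩, Finset.mem_univ _, by simp⟩
  · obtain ⟨⟨d, hd⟩, hj⟩ : ∃ d, ord v j = d := ⟨_, rfl⟩
    subst hd
    have hj' : (ord d.fst).symm ⟨d, rfl⟩ = j := by rw [← hj, Equiv.symm_apply_apply]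
    rw [hj, arcLoad, hj']

end Arcs

section Execution

variable {G ord}
variable (S0 : State G)

lemma evol_succ (t : ℕ) : evol G ord S0 (t + 1) = step G ord (evol G ord S0 t) :=
  Function.iterate_succ_apply' _ _ _

lemma cum_succ {t t' : ℕ} (h : t ≤ t') (d : G.Dart) :
    cum G ord S0 t (t' + 1) d = cum G ord S0 t t' d + load G ord S0 t' d :=
  Finset.sum_Ico_succ_top h _

lemma cum_add_cum {t₁ t₂ t₃ : ℕ} (h₁ : t₁ ≤ t₂) (h₂ : t₂ ≤ t₃) (d : G.Dart) :
    cum G ord S0 t₁ t₂ d + cum G ord S0 t₂ t₃ d = cum G ord S0 t₁ t₃ d :=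
  Finset.sum_Ico_consecutive _ h₁ h₂

/-- Tokens arriving at a vertex in one step are exactly those leaving it in the next. -/
lemma sum_inArcs_load (t : ℕ) (v : V) :
    ∑ d ∈ inArcs G v, load G ord S0 t d = ∑ d ∈ outArcs G v, load G ord S0 (t + 1) d := by
  rcases (G.degree v).eq_zero_or_pos with hv | hv
  · have hout : outArcs G v = ∅ := by
      refine Finset.eq_empty_of_forall_notMem fun d hd => ?_
      have := degree_pos_of_dart d
      rw [mem_outArcs.1 hd] at this
      omega
    have hin : inArcs G v = ∅ := by
      rw [← Finset.card_eq_zero, card_inArcs, hout, Finset.card_empty]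
    rw [hin, hout, Finset.sum_empty, Finset.sum_empty]
  · simp only [load]
    rw [sum_outArcs_arcLoad _ _ hv, evol_succ]
    simp [step, hv]

lemma sum_inArcs_cum (t t' : ℕ) (v : V) :
    ∑ d ∈ inArcs G v, cum G ord S0 t t' d =
      ∑ d ∈ outArcs G v, cum G ord S0 (t + 1) (t' + 1) d := by
  simp only [cum]
  rw [Finset.sum_comm, Finset.sum_comm (s := outArcs G v), ← Finset.sum_Ico_add']
  exact Finset.sum_congr rfl fun s _ => sum_inArcs_load S0 s v

lemma ptr_evol_eq {t t' : ℕ} (h : t ≤ t') {v : V} (hv : 0 < G.degree v) :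
    (evol G ord S0 t').ptr v =
      ((evol G ord S0 t).ptr v + cumV G ord S0 t t' v) % G.degree v := by
  induction t', h using Nat.le_induction with
  | base => simp [cumV, Nat.mod_eq_of_lt ((evol G ord S0 t).ptr_lt v hv)]
  | succ s hs ih =>
    rw [evol_succ, cumV, Finset.sum_Ico_succ_top hs]
    simp only [step, if_pos hv]
    rw [ih, Nat.mod_add_mod, cumV, add_assoc]

/-- The tokens sent along an arc over a window are those of a single round-robin run. -/
lemma cum_eq_sentCount {t t' : ℕ} (h : t ≤ t') (d : G.Dart) :
    cum G ord S0 t t' d = sentCount (G.degree d.fst) ((evol G ord S0 t).ptr d.fst)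
      (cumV G ord S0 t t' d.fst) ((ord d.fst).symm ⟨d, rfl⟩ : Fin (G.degree d.fst)) := by
  induction t', h using Nat.le_induction with
  | base => simp [cum, cumV, sentCount]
  | succ s hs ih =>
    rw [cum_succ S0 hs, ih, cumV, cumV, Finset.sum_Ico_succ_top hs, sentCount_add, ← cumV,
      ← ptr_evol_eq S0 hs (degree_pos_of_dart d)]
    rfl

lemma exists_cum_outArcs {t t' : ℕ} (h : t ≤ t') (v : V) :
    ∃ q : ℕ, ∀ d ∈ outArcs G v, cum G ord S0 t t' d = q ∨ cum G ord S0 t t' d = q + 1 := by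
  refine ⟨cumV G ord S0 t t' v / G.degree v, fun d hd => ?_⟩
  obtain rfl := mem_outArcs.1 hd
  rw [cum_eq_sentCount S0 h]
  exact sentCount_eq_or _ (Fin.is_lt _) (State.ptr_lt _ _ (degree_pos_of_dart d))

lemma abs_cum_outArcs_sub_le {t t' : ℕ} (h : t ≤ t') {v : V} {d d' : G.Dart}
    (hd : d ∈ outArcs G v) (hd' : d' ∈ outArcs G v) :
    |(cum G ord S0 t t' d : ℤ) - cum G ord S0 t t' d'| ≤ 1 := by
  obtain ⟨q, hq⟩ := exists_cum_outArcs (ord := ord) S0 h v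
  rw [abs_le]
  rcases hq d hd with h₁ | h₁ <;> rcases hq d' hd' with h₂ | h₂ <;> omega

lemma balancedFamily_cum {A : Finset G.Dart} {T N : ℕ}
    (hA : ∀ e ∈ A, ∀ e' ∈ A, ∀ t t', T ≤ t → t ≤ t' → t' ≤ T + N →
      |(cum G ord S0 t t' e : ℤ) - cum G ord S0 t t' e'| ≤ 1) :
    BalancedFamily N fun (e : A) s => (cum G ord S0 T (T + s) e : ℤ) := by
  refine ⟨fun e => by simp [cum], fun e e' s s' hs hs' => ?_⟩
  have h := hA e e.2 e' e'.2 (T + s) (T + s') (by omega) (by omega) (by omega)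
  have h₁ := cum_add_cum (ord := ord) S0 (Nat.le_add_right T s) (Nat.add_le_add_left hs T) e.1
  have h₂ := cum_add_cum (ord := ord) S0 (Nat.le_add_right T s) (Nat.add_le_add_left hs T) e'.1
  rw [abs_le] at h ⊢
  dsimp only
  omega

/-- Balanced incoming windows can be matched, arc by arc, with the outgoing ones. -/
lemma exists_equiv_inArcs_outArcs {T N : ℕ} {v : V}
    (hv : ∀ e ∈ inArcs G v, ∀ e' ∈ inArcs G v, ∀ t t', T ≤ t → t ≤ t' → t' ≤ T + N →
      |(cum G ord S0 t t' e : ℤ) - cum G ord S0 t t' e'| ≤ 1) :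
    ∃ φ : inArcs G v ≃ outArcs G v, ∀ e : inArcs G v, ∀ t, T ≤ t → t < T + N →
      load G ord S0 t e.1 = load G ord S0 (t + 1) (φ e).1 := by
  obtain ⟨φ, hφ⟩ := (balancedFamily_cum S0 hv).exists_equiv
    (balancedFamily_cum (ord := ord) S0 (A := outArcs G v) (T := T + 1) (N := N)
      fun e he e' he' t t' _ ht _ => abs_cum_outArcs_sub_le S0 ht he he')
    (by simpa using card_inArcs v)
    (fun s _ => by
      rw [Finset.sum_coe_sort (inArcs G v) fun e => (cum G ord S0 T (T + s) e : ℤ),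
        Finset.sum_coe_sort (outArcs G v) fun e => (cum G ord S0 (T + 1) (T + 1 + s) e : ℤ),
        show T + 1 + s = T + s + 1 by omega]
      exact_mod_cast sum_inArcs_cum S0 T (T + s) v)
  refine ⟨φ, fun e t ht ht' => ?_⟩
  obtain ⟨s, rfl⟩ := Nat.exists_eq_add_of_le ht
  have h₁ := hφ e s (by omega)
  have h₂ := hφ e (s + 1) (by omega)
  have h₃ := cum_succ (ord := ord) S0 ht e.1
  have h₄ := cum_succ (ord := ord) S0 (Nat.add_le_add_right ht 1) (φ e).1
  simp only [Nat.add_right_comm T 1, ← Nat.add_assoc] at h₁ h₂ h₃ h₄ ⊢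
  omega

lemma hasSubcycleDecomp_of_balanced {T N : ℕ}
    (h : ∀ v : V, ∀ e ∈ inArcs G v, ∀ e' ∈ inArcs G v, ∀ t t', T ≤ t → t ≤ t' → t' ≤ T + N →
      |(cum G ord S0 t t' e : ℤ) - cum G ord S0 t t' e'| ≤ 1) :
    HasSubcycleDecomp G ord S0 T N := by
  choose φ hφ using fun v => exists_equiv_inArcs_outArcs S0 (h v)
  let M : G.Dart → G.Dart := fun d => φ d.snd ⟨d, mem_inArcs.2 rfl⟩
  have hM : ∀ d, (M d).fst = d.snd := fun d => mem_outArcs.1 (φ d.snd _).2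
  have hMv : ∀ v d (hd : d ∈ inArcs G v), M d = φ v ⟨d, hd⟩ := by
    intro v d hd
    obtain rfl := mem_inArcs.1 hd
    rfl
  refine ⟨M, Finite.injective_iff_bijective.1 fun d d' hdd => ?_, hM, fun d t ht ht' => ?_⟩
  · have hsnd : d'.snd = d.snd := by rw [← hM, ← hM, hdd]
    rw [hMv d.snd d (mem_inArcs.2 rfl), hMv d.snd d' (mem_inArcs.2 hsnd)] at hdd
    exact congrArg Subtype.val ((φ d.snd).injective (Subtype.ext hdd))
  · exact hφ d.snd ⟨d, mem_inArcs.2 rfl⟩ t ht ht'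

lemma ValidMapping.cum_eq {T N : ℕ} {M : G.Dart → G.Dart} (hM : ValidMapping G ord S0 T N M)
    {t t' : ℕ} (ht : T ≤ t) (ht' : t' ≤ T + N) (d : G.Dart) :
    cum G ord S0 t t' d = cum G ord S0 (t + 1) (t' + 1) (M d) := by
  rw [cum, cum, ← Finset.sum_Ico_add']
  refine Finset.sum_congr rfl fun s hs => ?_
  rw [Finset.mem_Ico] at hs
  exact hM.2.2 d s (by omega) (by omega)

lemma ValidMapping.map_inArcs {T N : ℕ} {M : G.Dart → G.Dart} (hM : ValidMapping G ord S0 T N M)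
    (v : V) : (inArcs G v).val.map M = (outArcs G v).val := by
  have : (inArcs G v).map ⟨M, hM.1.injective⟩ = outArcs G v := by
    ext e
    obtain ⟨d, rfl⟩ := hM.1.surjective e
    simp [mem_inArcs, mem_outArcs, hM.2.1]
  rw [← this]
  rfl

/-- If a potential does not change in one step, the incoming windows are balanced. -/
lemma abs_cum_inArcs_sub_le_of_pot_eq {t i : ℕ}
    (h : pot G ord S0 i (t + 1) = pot G ord S0 i t) {v : V} {e e' : G.Dart}
    (he : e ∈ inArcs G v) (he' : e' ∈ inArcs G v) :
    |(cum G ord S0 t (t + i) e : ℤ) - cum G ord S0 t (t + i) e'| ≤ 1 := by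
  choose q hq using fun v =>
    exists_cum_outArcs (ord := ord) S0 (show t + 1 ≤ t + i + 1 by omega) v
  have hex : ∀ v, _ := fun v => sum_sq_sub_sum_sq (q := (q v : ℤ))
    (f := fun d => (cum G ord S0 t (t + i) d : ℤ))
    (g := fun d => (cum G ord S0 (t + 1) (t + i + 1) d : ℤ)) (card_inArcs v)
    (by exact_mod_cast sum_inArcs_cum S0 t (t + i) v)
    (fun d hd => by exact_mod_cast hq v d hd)
  have hnonneg : ∀ x y : ℤ, 0 ≤ (x - y) * (x - (y + 1)) := by
    intro x y
    rcases le_or_gt x y with hxy | hxy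
    · exact mul_nonneg_of_nonpos_of_nonpos (by omega) (by omega)
    · exact mul_nonneg (by omega) (by omega)
  have htotal : ∑ v, ∑ d ∈ inArcs G v, ((cum G ord S0 t (t + i) d : ℤ) - q v) *
      ((cum G ord S0 t (t + i) d : ℤ) - (q v + 1)) = 0 := by
    rw [← Finset.sum_congr rfl fun v _ => hex v, Finset.sum_sub_distrib, sum_inArcs, sum_outArcs,
      sub_eq_zero]
    rw [pot, pot, Nat.add_right_comm] at h
    exact_mod_cast h.symm
  have hv := (Finset.sum_eq_zero_iff_of_nonneg fun v _ =>
    Finset.sum_nonneg fun d _ => hnonneg _ _).1 htotal v (Finset.mem_univ v)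
  have hval := (Finset.sum_eq_zero_iff_of_nonneg fun d _ => hnonneg _ _).1 hv
  have h₁ := mul_eq_zero.1 (hval e he)
  have h₂ := mul_eq_zero.1 (hval e' he')
  rw [abs_le]
  omega

lemma pot_succ_eq_of_map_eq {t i : ℕ}
    (h : Multiset.map (cum G ord S0 t (t + i)) (Finset.univ : Finset G.Dart).val =
      Multiset.map (cum G ord S0 (t + 1) (t + i + 1)) (Finset.univ : Finset G.Dart).val) :
    pot G ord S0 i (t + 1) = pot G ord S0 i t := by
  have := congrArg (fun m => (m.map (· ^ 2)).sum) h
  simp only [Multiset.map_map] at this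
  rw [pot, pot, Nat.add_right_comm]
  exact this.symm

end Execution

/-- Equivalent characterizations of a `Δt`-step subcycle decomposition:
(i) existence of the decomposition; (ii) local preservation of the multisets of cumulative
loads; (iii) global preservation of the multisets of cumulative loads; (iv) constancy of
the potentials `Φ_i`; (v) incoming cumulative discrepancy at most one. -/
theorem subcycle_decomposition_tfae (hconn : G.Connected) (S0 : State G)
    (T Δt : ℕ) (hΔt : 1 ≤ Δt) :
    [ HasSubcycleDecomp G ord S0 T Δt,
      ∀ v : V, ∀ t t' : ℕ, T ≤ t → t ≤ t' → t' ≤ T + Δt →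
        Multiset.map (cum G ord S0 t t') (inArcs G v).val =
          Multiset.map (cum G ord S0 (t + 1) (t' + 1)) (outArcs G v).val,
      ∀ t t' : ℕ, T ≤ t → t ≤ t' → t' ≤ T + Δt →
        Multiset.map (cum G ord S0 t t') (Finset.univ : Finset G.Dart).val =
          Multiset.map (cum G ord S0 (t + 1) (t' + 1)) (Finset.univ : Finset G.Dart).val,
      ∀ i : ℕ, i ≤ Δt → ∀ j : ℕ, j ≤ Δt - i + 1 →
        pot G ord S0 i (T + j) = pot G ord S0 i T,
      ∀ v : V, ∀ e1 ∈ inArcs G v, ∀ e2 ∈ inArcs G v, ∀ t t' : ℕ,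
        T ≤ t → t ≤ t' → t' ≤ T + Δt →
        |(cum G ord S0 t t' e1 : ℤ) - (cum G ord S0 t t' e2 : ℤ)| ≤ 1 ].TFAE := by
  tfae_have 1 → 2 := by
    rintro ⟨M, hM⟩ v t t' ht _ ht'
    rw [← ValidMapping.map_inArcs S0 hM v, Multiset.map_map]
    exact Multiset.map_congr rfl fun d _ => hM.cum_eq S0 ht ht' d
  tfae_have 2 → 3 := by
    intro h t t' ht htt ht'
    rw [map_val_eq_sum_singleton, map_val_eq_sum_singleton, ← sum_inArcs, ← sum_outArcs]
    refine Finset.sum_congr rfl fun v _ => ?_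
    rw [← map_val_eq_sum_singleton, ← map_val_eq_sum_singleton]
    exact h v t t' ht htt ht'
  tfae_have 3 → 4 := by
    intro h i hi j hj
    induction j with
    | zero => rfl
    | succ j ih =>
      rw [← ih (by omega), ← add_assoc]
      exact pot_succ_eq_of_map_eq S0 (h (T + j) (T + j + i) (by omega) (by omega) (by omega))
  tfae_have 4 → 5 := by
    intro h v e he e' he' t t' ht htt ht'
    obtain ⟨j, rfl⟩ := Nat.exists_eq_add_of_le ht
    obtain ⟨i, rfl⟩ := Nat.exists_eq_add_of_le htt
    refine abs_cum_inArcs_sub_le_of_pot_eq S0 ?_ he he'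
    rw [h i (by omega) j (by omega), add_assoc, h i (by omega) (j + 1) (by omega)]
  tfae_have 5 → 1 := hasSubcycleDecomp_of_balanced S0
  tfae_finish

end RotorRouter
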